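/- Let A, Ã ∈ ℝ^{N×N} be nonnegative matrices agreeing outside a set of perturbed edges δE, with source set S and tip set T, and assume all row sums d_i = Σ_j A_{ij} and d̃_i = Σ_j Ã_{ij} are positive. Let P = D^{−1} A and P̃ = D̃^{−1} Ã be the associated transition matrices, where D = diag(d_1,…,d_N) and D̃ = diag(d̃_1,…,d̃_N). Then for all indices k, ℓ and every real polynomial p of degree at most dist_A(k,S) + min{dist_A(T,ℓ), dist_A(S,ℓ) − 1}, one has (p(P))_{kℓ} = (p(P̃))_{kℓ}. -/

import Mathlib

open Matrix

/-- A walk of length `n` from `k` to `l` in the weighted directed graph determined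
by the matrix `A` (an edge from `i` to `j` exists iff `A i j > 0`). -/
def IsWalk {N : ℕ} (A : Matrix (Fin N) (Fin N) ℝ) (k l : Fin N) (n : ℕ) : Prop :=
  ∃ u : ℕ → Fin N, u 0 = k ∧ u n = l ∧ ∀ i < n, 0 < A (u i) (u (i + 1))

/-- The geodesic (shortest-path) distance from `k` to `l` in the graph of `A`,
with value `⊤` if there is no walk from `k` to `l`. -/
noncomputable def distA {N : ℕ} (A : Matrix (Fin N) (Fin N) ℝ) (k l : Fin N) : ℕ∞ :=
  ⨅ n ∈ {n : ℕ | IsWalk A k l n}, (n : ℕ∞)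

/-- Distance from a node `k` to a set of nodes `S`. -/
noncomputable def distToSet {N : ℕ} (A : Matrix (Fin N) (Fin N) ℝ) (k : Fin N)
    (S : Set (Fin N)) : ℕ∞ := ⨅ s ∈ S, distA A k s

/-- Distance from a set of nodes `S` to a node `l`. -/
noncomputable def distFromSet {N : ℕ} (A : Matrix (Fin N) (Fin N) ℝ) (S : Set (Fin N))
    (l : Fin N) : ℕ∞ := ⨅ s ∈ S, distA A s l

lemma IsWalk.nil {N : ℕ} (A : Matrix (Fin N) (Fin N) ℝ) (k : Fin N) : IsWalk A k k 0 :=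
  ⟨fun _ => k, rfl, rfl, by simp⟩

lemma IsWalk.cons {N : ℕ} {A : Matrix (Fin N) (Fin N) ℝ} {k j l : Fin N} {n : ℕ}
    (h : 0 < A k j) (hw : IsWalk A j l n) : IsWalk A k l (n + 1) := by
  obtain ⟨u, h0, hn, hu⟩ := hw
  refine ⟨fun i => Nat.casesOn i k u, rfl, hn, fun i hi => ?_⟩
  cases i with
  | zero => simpa [h0] using h
  | succ i => exact hu i (by omega)

lemma distToSet_le_of_isWalk {N : ℕ} {A : Matrix (Fin N) (Fin N) ℝ} {k s : Fin N}
    {S : Set (Fin N)} {n : ℕ} (hs : s ∈ S) (hw : IsWalk A k s n) : distToSet A k S ≤ n :=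
  (iInf₂_le s hs).trans (iInf₂_le (f := fun (n : ℕ) _ => (n : ℕ∞)) n hw)

lemma distFromSet_le_of_isWalk {N : ℕ} {A : Matrix (Fin N) (Fin N) ℝ} {s l : Fin N}
    {S : Set (Fin N)} {n : ℕ} (hs : s ∈ S) (hw : IsWalk A s l n) : distFromSet A S l ≤ n :=
  (iInf₂_le s hs).trans (iInf₂_le (f := fun (n : ℕ) _ => (n : ℕ∞)) n hw)

lemma exists_ne_zero_of_pow_succ_apply_ne_zero {N : ℕ} {M : Matrix (Fin N) (Fin N) ℝ}
    {k l : Fin N} {n : ℕ} (h : (M ^ (n + 1)) k l ≠ 0) :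
    ∃ j, M k j ≠ 0 ∧ (M ^ n) j l ≠ 0 := by
  rw [pow_succ', Matrix.mul_apply] at h
  obtain ⟨j, -, hj⟩ := Finset.exists_ne_zero_of_sum_ne_zero h
  exact ⟨j, left_ne_zero_of_mul hj, right_ne_zero_of_mul hj⟩

/-- A nonzero entry of the `n`-th power of a matrix supported on the edges of the graph of `A`
yields a walk of length `n`. -/
lemma isWalk_of_pow_apply_ne_zero {N : ℕ} {A M : Matrix (Fin N) (Fin N) ℝ}
    (hM : ∀ i j, M i j ≠ 0 → 0 < A i j) {l : Fin N} {n : ℕ} :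
    ∀ {k : Fin N}, (M ^ n) k l ≠ 0 → IsWalk A k l n := by
  induction n with
  | zero =>
    intro k h
    obtain rfl : k = l := by
      by_contra hkl
      exact h (by simp [hkl])
    exact .nil A k
  | succ n ih =>
    intro k h
    obtain ⟨j, hkj, hjl⟩ := exists_ne_zero_of_pow_succ_apply_ne_zero h
    exact (ih hjl).cons (hM k j hkj)

/-- If `M` is supported on the edges of the graph of `A` outside the rows in `S`, then a nonzero
entry of `M ^ n` in a column of `S` yields a walk of length at most `n` into `S`. -/
lemma exists_isWalk_le_of_pow_apply_ne_zero {N : ℕ} {A M : Matrix (Fin N) (Fin N) ℝ}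
    {S : Set (Fin N)} (hM : ∀ i ∉ S, ∀ j, M i j ≠ 0 → 0 < A i j) {s : Fin N} (hs : s ∈ S)
    {n : ℕ} : ∀ {k : Fin N}, (M ^ n) k s ≠ 0 → ∃ t ∈ S, ∃ m ≤ n, IsWalk A k t m := by
  induction n with
  | zero =>
    intro k h
    obtain rfl : k = s := by
      by_contra hks
      exact h (by simp [hks])
    exact ⟨k, hs, 0, le_rfl, .nil A k⟩
  | succ n ih =>
    intro k h
    by_cases hk : k ∈ S
    · exact ⟨k, hk, 0, Nat.zero_le _, .nil A k⟩
    obtain ⟨j, hkj, hjs⟩ := exists_ne_zero_of_pow_succ_apply_ne_zero h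
    obtain ⟨t, ht, m, hm, hw⟩ := ih hjs
    exact ⟨t, ht, m + 1, by omega, hw.cons (hM k hk j hkj)⟩

lemma pow_apply_eq_of_exchange {N : ℕ} {M M' : Matrix (Fin N) (Fin N) ℝ} {k l : Fin N} {n : ℕ}
    (h : ∀ a b s u, a + b + 1 = n → (M' ^ a) k s ≠ 0 → (M ^ b) u l ≠ 0 → M s u = M' s u) :
    (M ^ n) k l = (M' ^ n) k l := by
  have step : ∀ a b, a + b = n → (M ^ n) k l = (M' ^ a * M ^ b) k l := by
    intro a
    induction a with
    | zero => rintro b rfl; simp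
    | succ a ih =>
      intro b hab
      rw [ih (b + 1) (by omega), pow_succ' M, pow_succ M', Matrix.mul_assoc]
      simp only [Matrix.mul_apply, Finset.mul_sum]
      refine Finset.sum_congr rfl fun s _ => Finset.sum_congr rfl fun u _ => ?_
      by_cases hs : (M' ^ a) k s = 0
      · simp [hs]
      by_cases hu : (M ^ b) u l = 0
      · simp [hu]
      rw [h a b s u (by omega) hs hu]
  simpa using step n 0 rfl

/-- Transition-matrix stability (Lemma 5.9): if the nonnegative matrices `A` and `B`
agree outside the perturbed edge set `δE` (sources `S`, tips `T`), all row sums are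
positive and `P = D⁻¹A`, `P' = D'⁻¹B` are the associated transition matrices, then for
all `k, l` and every real polynomial `p` of degree at most
`distA(k,S) + min (distA(T,l)) (distA(S,l) - 1)` (expressed as the conjunction
`deg p ≤ distA(k,S) + distA(T,l)` and `deg p + 1 ≤ distA(k,S) + distA(S,l)`),
one has `(p(P)) k l = (p(P')) k l`. -/
theorem aeval_transition_entry_eq {N : ℕ}
    (A B : Matrix (Fin N) (Fin N) ℝ)
    (hA : ∀ i j, 0 ≤ A i j) (hB : ∀ i j, 0 ≤ B i j)
    (δE : Set (Fin N × Fin N))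
    (hagree : ∀ i j, (i, j) ∉ δE → A i j = B i j)
    (hd : ∀ i, 0 < ∑ j, A i j) (hd' : ∀ i, 0 < ∑ j, B i j)
    (k l : Fin N) (p : Polynomial ℝ)
    (hdeg₁ : (p.natDegree : ℕ∞) ≤ distToSet A k {s | ∃ t, (s, t) ∈ δE} +
      distFromSet A {t | ∃ s, (s, t) ∈ δE} l)
    (hdeg₂ : (p.natDegree : ℕ∞) + 1 ≤ distToSet A k {s | ∃ t, (s, t) ∈ δE} +
      distFromSet A {s | ∃ t, (s, t) ∈ δE} l) :
    (Polynomial.aeval (Matrix.diagonal (fun i => (∑ j, A i j)⁻¹) * A) p) k l =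
    (Polynomial.aeval (Matrix.diagonal (fun i => (∑ j, B i j)⁻¹) * B) p) k l := by
  set S : Set (Fin N) := {s | ∃ t, (s, t) ∈ δE}
  set T : Set (Fin N) := {t | ∃ s, (s, t) ∈ δE}
  set P := Matrix.diagonal (fun i => (∑ j, A i j)⁻¹) * A with hP
  set P' := Matrix.diagonal (fun i => (∑ j, B i j)⁻¹) * B with hP'
  have hPA : ∀ i j, P i j ≠ 0 → 0 < A i j := fun i j h =>
    (hA i j).lt_of_ne' fun h0 => h (by simp [hP, Matrix.diagonal_mul, h0])
  have hrow : ∀ i ∉ S, ∀ j, P i j = P' i j := by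
    intro i hi j
    have hAB : ∀ j, A i j = B i j := fun j => hagree i j fun hij => hi ⟨j, hij⟩
    simp [hP, hP', Matrix.diagonal_mul, hAB]
  have hP'A : ∀ i ∉ S, ∀ j, P' i j ≠ 0 → 0 < A i j := fun i hi j h =>
    hPA i j (by rwa [hrow i hi j])
  have hpow : ∀ n ≤ p.natDegree, (P ^ n) k l = (P' ^ n) k l := by
    intro n hn
    refine pow_apply_eq_of_exchange fun a b s u hab hks hul => ?_
    by_contra hsu
    have hs : s ∈ S := by
      by_contra hs
      exact hsu (hrow s hs u)
    obtain ⟨t, ht, m, hm, hw⟩ := exists_isWalk_le_of_pow_apply_ne_zero hP'A hs hks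
    have hw' : IsWalk A u l b := isWalk_of_pow_apply_ne_zero hPA hul
    have hto := distToSet_le_of_isWalk ht hw
    by_cases hδ : (s, u) ∈ δE
    · have hle := hdeg₁.trans (add_le_add hto (distFromSet_le_of_isWalk (S := T) ⟨s, hδ⟩ hw'))
      norm_cast at hle
      omega
    · have hAsu : 0 < A s u := (hA s u).lt_of_ne' fun h0 => hsu (by
        simp [hP, hP', Matrix.diagonal_mul, ← hagree s u hδ, h0])
      have hle := hdeg₂.trans (add_le_add hto (distFromSet_le_of_isWalk hs (hw'.cons hAsu)))
      norm_cast at hle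
      omega
  simp only [Polynomial.aeval_eq_sum_range, Matrix.sum_apply, Matrix.smul_apply]
  exact Finset.sum_congr rfl fun n hn => by
    rw [hpow n (Nat.lt_succ_iff.mp (Finset.mem_range.mp hn))]
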